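/- arXiv:1710.11312 — 3 statements merged into one kernel-verified Lean document; each statement's English description precedes it below -/
import Mathlib

section
/- Let p ≥ 1 and suppose u₀ ∈ C⁰(ℝⁿ) satisfies u₀(x) ≥ c₀·exp(−α·exp(β|x|^γ)) for all x ∈ ℝⁿ, with positive constants c₀, α, β, γ. Then there exist t₀ > e and C > 0 such that any positive classical solution u of the Cauchy problem (0) on ℝⁿ×(0,∞) satisfies ‖u(·,t)‖_{L^∞(ℝⁿ)} ≥ C · t^{−1/p} · (ln ln t)^{2/(pγ)} for all t ≥ t₀. -/
open Real Set MeasureTheory Metric Filter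

/-- The Laplacian of a function on `ℝⁿ`, written via iterated Fréchet derivatives
in the coordinate directions. -/
noncomputable def lap {n : ℕ} (f : EuclideanSpace ℝ (Fin n) → ℝ)
    (x : EuclideanSpace ℝ (Fin n)) : ℝ :=
  ∑ i : Fin n, fderiv ℝ (fun y => fderiv ℝ f y (EuclideanSpace.single i 1)) x
    (EuclideanSpace.single i 1)

/-- `u` is a positive classical solution of the Cauchy problem `u_t = u^p Δu`,
`u(·,0) = u₀`, on `ℝⁿ × (0,T)`: it is continuous on `ℝⁿ × [0,T)`, attains the initial
data, is positive and spatially `C²` for `0 < t < T`, and satisfies the PDE pointwise. -/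
def IsSolOn (n : ℕ) (p : ℝ) (u₀ : EuclideanSpace ℝ (Fin n) → ℝ)
    (u : EuclideanSpace ℝ (Fin n) → ℝ → ℝ) (T : ℝ) : Prop :=
  ContinuousOn (fun z : (EuclideanSpace ℝ (Fin n)) × ℝ => u z.1 z.2) {z | 0 ≤ z.2 ∧ z.2 < T} ∧
  (∀ x, u x 0 = u₀ x) ∧
  (∀ x, ∀ t, 0 < t → t < T → 0 < u x t) ∧
  (∀ t, 0 < t → t < T → ContDiff ℝ 2 (fun y => u y t)) ∧
  (∀ x, ∀ t, 0 < t → t < T →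
    HasDerivAt (fun s => u x s) (u x t ^ p * lap (fun y => u y t) x) t)

/-- `u` is a global positive classical solution of the Cauchy problem
`u_t = u^p Δu` on `ℝⁿ × (0,∞)`, `u(·,0) = u₀`. -/
def IsSol (n : ℕ) (p : ℝ) (u₀ : EuclideanSpace ℝ (Fin n) → ℝ)
    (u : EuclideanSpace ℝ (Fin n) → ℝ → ℝ) : Prop :=
  ContinuousOn (fun z : (EuclideanSpace ℝ (Fin n)) × ℝ => u z.1 z.2) {z | 0 ≤ z.2} ∧
  (∀ x, u x 0 = u₀ x) ∧
  (∀ x, ∀ t, 0 < t → 0 < u x t) ∧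
  (∀ t, 0 < t → ContDiff ℝ 2 (fun y => u y t)) ∧
  (∀ x, ∀ t, 0 < t →
    HasDerivAt (fun s => u x s) (u x t ^ p * lap (fun y => u y t) x) t)

/-- `u` is the minimal global positive classical solution of the Cauchy problem:
whenever `T ∈ (0,∞]` and `v` is a positive classical solution on `ℝⁿ × (0,T)`, then
`u ≤ v` there.  (Quantifying over all finite `T > 0` covers `T = ∞`, since the
restriction of a global solution solves the problem on every `(0,T)`.) -/
def IsMinimalSol (n : ℕ) (p : ℝ) (u₀ : EuclideanSpace ℝ (Fin n) → ℝ)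
    (u : EuclideanSpace ℝ (Fin n) → ℝ → ℝ) : Prop :=
  IsSol n p u₀ u ∧
  ∀ T > (0:ℝ), ∀ v, IsSolOn n p u₀ v T → ∀ x, ∀ t, 0 ≤ t → t < T → u x t ≤ v x t

/-- A `C²`-type necessary second-order condition at a local minimum in dimension one. -/
lemma second_deriv_nonneg {g : ℝ → ℝ} (hmin : IsLocalMin g 0) (hc : ContinuousAt g 0) :
    0 ≤ deriv (deriv g) 0 := by
  by_contra hneg
  push Not at hneg
  have hd : deriv g 0 = 0 := hmin.deriv_eq_zero
  have h1 : IsLocalMax g 0 := isLocalMax_of_deriv_deriv_neg hneg hd hc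
  have h2 : g =ᶠ[nhds 0] fun _ => g 0 := by
    filter_upwards [hmin, h1] with y hy1 hy2
    exact le_antisymm hy2 hy1
  have h3 := h2.deriv.deriv_eq
  simp at h3
  linarith

/-- If `f + A‖·‖²` has a local minimum at `x`, then `Δ f x ≥ -2nA`. -/
lemma lap_ge {n : ℕ} {f : EuclideanSpace ℝ (Fin n) → ℝ} (hf : ContDiff ℝ 2 f) (A : ℝ)
    (x : EuclideanSpace ℝ (Fin n)) (hmin : IsLocalMin (fun y => f y + A * ‖y‖ ^ 2) x) :
    -(2 * n * A) ≤ lap f x := by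
  have key : ∀ i : Fin n, -(2 * A) ≤
      fderiv ℝ (fun y => fderiv ℝ f y (EuclideanSpace.single i 1)) x
        (EuclideanSpace.single i 1) := by
    intro i
    set e : EuclideanSpace ℝ (Fin n) := EuclideanSpace.single i 1 with he
    have hline : ∀ s : ℝ, HasDerivAt (fun s : ℝ => x + s • e) e s := by
      intro s
      simpa using ((hasDerivAt_id s).smul_const e).const_add x
    have hen : ‖e‖ = 1 := by simp [he]
    have hnorm : ∀ s : ℝ, ‖x + s • e‖ ^ 2 = ‖x‖ ^ 2 + 2 * s * inner ℝ x e + s ^ 2 := by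
      intro s
      rw [norm_add_sq_real, inner_smul_right, norm_smul, hen]
      simp; ring
    set g : ℝ → ℝ := fun s => f (x + s • e) + A * (‖x‖ ^ 2 + 2 * s * inner ℝ x e + s ^ 2) with hg
    have hgd : ∀ s, HasDerivAt g
        (fderiv ℝ f (x + s • e) e + A * (2 * inner ℝ x e + 2 * s)) s := by
      intro s
      have h1 : HasDerivAt (fun s : ℝ => f (x + s • e)) (fderiv ℝ f (x + s • e) e) s :=
        ((hf.differentiable (by norm_num)) (x + s • e)).hasFDerivAt.comp_hasDerivAt s (hline s)
      have h2 : HasDerivAt (fun s : ℝ => ‖x‖ ^ 2 + 2 * s * inner ℝ x e + s ^ 2)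
          (2 * inner ℝ x e + 2 * s) s := by
        have := ((((hasDerivAt_id s).const_mul 2).mul_const (inner ℝ x e)).const_add
          (‖x‖ ^ 2)).add ((hasDerivAt_id s).pow 2)
        refine HasDerivAt.congr_deriv this ?_
        simp
      exact h1.add (h2.const_mul A)
    have hg' : deriv g = fun s => fderiv ℝ f (x + s • e) e + A * (2 * inner ℝ x e + 2 * s) :=
      funext fun s => (hgd s).deriv
    have hF : DifferentiableAt ℝ (fun y => fderiv ℝ f y e) (x + (0:ℝ) • e) := by
      have : ContDiff ℝ 1 (fderiv ℝ f) := hf.fderiv_right (by norm_num)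
      exact ((this.differentiable (by norm_num)) _).clm_apply (differentiableAt_const e)
    have hg'' : deriv (deriv g) 0 = fderiv ℝ (fun y => fderiv ℝ f y e) x e + A * 2 := by
      rw [hg']
      have h1 := hF.hasFDerivAt.comp_hasDerivAt (0:ℝ) (hline 0)
      have h2 : HasDerivAt (fun s : ℝ => 2 * inner ℝ x e + 2 * s) 2 0 := by
        simpa using ((hasDerivAt_id (0:ℝ)).const_mul 2).const_add (2 * inner ℝ x e)
      have h3 := (h1.add (h2.const_mul A)).deriv
      rw [zero_smul, add_zero] at h3
      exact h3
    have hgmin : IsLocalMin g 0 := by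
      have ht : Tendsto (fun s : ℝ => x + s • e) (nhds 0) (nhds x) := by
        have := (hline 0).continuousAt.tendsto
        simpa using this
      filter_upwards [ht.eventually hmin] with s hs
      rw [hnorm s] at hs
      simpa [hg] using hs
    have := second_deriv_nonneg hgmin (hgd 0).continuousAt
    rw [hg''] at this
    linarith
  have hs := Finset.sum_le_sum (s := Finset.univ) fun i _ => key i
  rw [Finset.sum_const, Finset.card_univ, Fintype.card_fin, nsmul_eq_mul] at hs
  unfold lap
  linarith

/-- Comparison with the separable subsolution on the ball of radius `R`. -/
lemma comparison {n : ℕ} {p : ℝ} (hp : 1 ≤ p) {u₀ : EuclideanSpace ℝ (Fin n) → ℝ}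
    {u : EuclideanSpace ℝ (Fin n) → ℝ → ℝ} (hu : IsSol n p u₀ u)
    {R τ c : ℝ} (hR : 0 < R) (hτ : 0 < τ) (hc : 0 < c) (hcn : 2 * n * p * c ^ p < 1)
    (h0 : ∀ x, ‖x‖ ≤ R → c * (R ^ 2 / τ) ^ (1 / p) < u₀ x) {t : ℝ} (ht : 0 < t) :
    c * (R ^ 2 / (τ + t)) ^ (1 / p) ≤ u 0 t := by
  obtain ⟨hcont, hinit, hpos, hC2, hpde⟩ := hu
  have hp0 : 0 < p := by linarith
  set B : ℝ → ℝ := fun s => c * (R ^ 2 / (τ + s)) ^ (1 / p) with hB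
  set w : EuclideanSpace ℝ (Fin n) → ℝ → ℝ := fun x s => B s * (1 - ‖x‖ ^ 2 / R ^ 2) with hw
  have hBpos : ∀ s, 0 ≤ s → 0 < B s := by
    intro s hs
    have : 0 < R ^ 2 / (τ + s) := by positivity
    simp only [hB]; positivity
  have hBp : ∀ s, 0 ≤ s → B s ^ p = c ^ p * (R ^ 2 / (τ + s)) := by
    intro s hs
    have : 0 < R ^ 2 / (τ + s) := by positivity
    simp only [hB]
    rw [Real.mul_rpow hc.le (by positivity), ← Real.rpow_mul this.le, one_div,
      inv_mul_cancel₀ hp0.ne', Real.rpow_one]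
  have hBd : ∀ s, 0 < s → HasDerivAt B (-(1 / p) * B s / (τ + s)) s := by
    intro s hs
    have hts : 0 < τ + s := by positivity
    have hq : 0 < R ^ 2 / (τ + s) := by positivity
    have h1 : HasDerivAt (fun s : ℝ => R ^ 2 / (τ + s)) (-(R ^ 2) / (τ + s) ^ 2) s := by
      have := (hasDerivAt_const s (R ^ 2)).div ((hasDerivAt_id s).const_add τ) hts.ne'
      refine HasDerivAt.congr_deriv this ?_
      simp
    have h2 := (h1.rpow_const (p := 1 / p) (Or.inl hq.ne')).const_mul c
    refine HasDerivAt.congr_deriv h2 ?_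
    simp only [hB]
    rw [Real.rpow_sub_one hq.ne']
    field_simp
  have hBc : ContinuousOn B (Icc 0 t) := by
    intro s hs
    have hts : 0 < τ + s := by have := hs.1; positivity
    have hq : 0 < R ^ 2 / (τ + s) := by positivity
    apply ContinuousAt.continuousWithinAt
    apply ContinuousAt.mul continuousAt_const
    have hq' : ContinuousAt (fun s : ℝ => R ^ 2 / (τ + s)) s :=
      continuousAt_const.div (continuousAt_const.add continuousAt_id) hts.ne'
    exact hq'.rpow_const (Or.inl hq.ne')
  by_contra hlt
  push Not at hlt
  -- the compact set where the solution lies below the subsolution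
  set Q : Set (EuclideanSpace ℝ (Fin n) × ℝ) := closedBall 0 R ×ˢ Icc 0 t with hQ
  have hQc : IsCompact Q := (isCompact_closedBall _ _).prod isCompact_Icc
  have hφ : ContinuousOn (fun z : EuclideanSpace ℝ (Fin n) × ℝ => u z.1 z.2 - w z.1 z.2) Q := by
    apply ContinuousOn.sub
    · exact hcont.mono fun z hz => hz.2.1
    · apply ContinuousOn.mul
      · exact hBc.comp continuousOn_snd fun z hz => hz.2
      · apply Continuous.continuousOn
        fun_prop
  set K : Set (EuclideanSpace ℝ (Fin n) × ℝ) :=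
    Q ∩ (fun z : EuclideanSpace ℝ (Fin n) × ℝ => u z.1 z.2 - w z.1 z.2) ⁻¹' Iic 0 with hK
  have hKc : IsCompact K := by
    have : IsClosed K := hφ.preimage_isClosed_of_isClosed hQc.isClosed isClosed_Iic
    exact hQc.of_isClosed_subset this inter_subset_left
  have hKne : K.Nonempty := by
    refine ⟨(0, t), ⟨⟨by simp [hR.le], ⟨ht.le, le_rfl⟩⟩, ?_⟩⟩
    simp only [mem_preimage, mem_Iic, hw, norm_zero]
    have : B t = c * (R ^ 2 / (τ + t)) ^ (1 / p) := rfl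
    norm_num
    linarith
  obtain ⟨⟨x, s⟩, hxs, hmin⟩ := hKc.exists_isMinOn hKne continuousOn_snd
  obtain ⟨⟨hxR, hs0, hst⟩, hle⟩ := hxs
  simp only [mem_preimage, mem_Iic, mem_closedBall, dist_zero_right] at hxR hle hs0 hst
  have hwB : ∀ y r, 0 ≤ r → w y r ≤ B r := by
    intro y r hr
    have : 0 ≤ ‖y‖ ^ 2 / R ^ 2 := by positivity
    have := hBpos r hr
    simp only [hw]
    nlinarith
  -- before time `s` the solution is strictly above
  have habove : ∀ y r, ‖y‖ ≤ R → 0 ≤ r → r < s → w y r < u y r := by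
    intro y r hy hr hrs
    by_contra hcon
    push Not at hcon
    have : (y, r) ∈ K := ⟨⟨by simpa using hy, hr, by simp only; linarith⟩, by
      simp only [mem_preimage, mem_Iic]; linarith⟩
    have := hmin this
    simp only [mem_ofPred_eq] at this
    linarith
  have hs : 0 < s := by
    rcases hs0.lt_or_eq with h | h
    · exact h
    · exfalso
      subst h
      have h1 := h0 x hxR
      have h2 := hwB x 0 le_rfl
      have h3 : B 0 = c * (R ^ 2 / τ) ^ (1 / p) := by simp [hB]
      rw [hinit] at hle
      linarith
  have hus : 0 < u x s := hpos x s hs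
  have hxlt : ‖x‖ < R := by
    rcases hxR.lt_or_eq with h | h
    · exact h
    · exfalso
      have : w x s = 0 := by
        simp only [hw, h]
        rw [div_self (by positivity)]; simp
      linarith
  have hdiff : ∀ y, HasDerivAt (fun r => u y r - w y r)
      (u y s ^ p * lap (fun z => u z s) y
        - (-(1 / p) * B s / (τ + s)) * (1 - ‖y‖ ^ 2 / R ^ 2)) s := fun y =>
    (hpde y s hs).sub ((hBd s hs).mul_const _)
  have hleft : ∀ᶠ r in nhdsWithin s (Iio s), 0 ≤ r ∧ r < s := by
    have h1 : ∀ᶠ r in nhdsWithin s (Iio s), 0 < r :=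
      nhdsWithin_le_nhds (lt_mem_nhds hs)
    filter_upwards [h1, self_mem_nhdsWithin] with r hr1 hr2
    exact ⟨hr1.le, hr2⟩
  have hge : ∀ y, ‖y‖ ≤ R → w y s ≤ u y s := by
    intro y hy
    have h1 : Tendsto (fun r => u y r - w y r) (nhdsWithin s (Iio s)) (nhds (u y s - w y s)) :=
      (hdiff y).continuousAt.tendsto.mono_left nhdsWithin_le_nhds
    have h2 : 0 ≤ u y s - w y s := by
      apply ge_of_tendsto h1
      filter_upwards [hleft] with r hr
      have := habove y r hy hr.1 hr.2
      linarith
    linarith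
  have heq : u x s = w x s := le_antisymm (by linarith) (hge x hxR)
  -- time derivative
  have htime : u x s ^ p * lap (fun z => u z s) x
        - (-(1 / p) * B s / (τ + s)) * (1 - ‖x‖ ^ 2 / R ^ 2) ≤ 0 := by
    have h1 := (hasDerivAt_iff_tendsto_slope.mp (hdiff x)).mono_left
      (nhdsWithin_mono s (fun r (hr : r ∈ Iio s) => ne_of_lt hr))
    apply le_of_tendsto h1
    filter_upwards [hleft] with r hr
    have h2 := habove x r hxR hr.1 hr.2
    rw [slope_def_field]
    apply div_nonpos_of_nonneg_of_nonpos <;> linarith [hr.2]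
  -- space derivative
  have hlap : -(2 * n * (B s / R ^ 2)) ≤ lap (fun z => u z s) x := by
    apply lap_ge (hC2 s hs)
    have hnb : ∀ᶠ y in nhds x, ‖y‖ < R := continuous_norm.continuousAt.eventually_lt
      continuousAt_const hxlt
    filter_upwards [hnb] with y hy
    have h1 := hge y hy.le
    have e1 : w y s = B s - B s / R ^ 2 * ‖y‖ ^ 2 := by simp only [hw]; ring
    have e2 : w x s = B s - B s / R ^ 2 * ‖x‖ ^ 2 := by simp only [hw]; ring
    linarith
  have hBs := hBpos s hs.le
  have hts : 0 < τ + s := by positivity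
  have hws : 0 < w x s := heq ▸ hus
  have e3 : (-(1 / p) * B s / (τ + s)) * (1 - ‖x‖ ^ 2 / R ^ 2) = -(w x s / (p * (τ + s))) := by
    simp only [hw]; field_simp
  rw [e3, heq] at htime
  have hwp : w x s ^ p = w x s ^ (p - 1) * w x s := by
    rw [Real.rpow_sub_one hws.ne']; field_simp
  have hBp1 : B s ^ p = B s ^ (p - 1) * B s := by
    rw [Real.rpow_sub_one hBs.ne']; field_simp
  have hmono : w x s ^ (p - 1) ≤ B s ^ (p - 1) :=
    Real.rpow_le_rpow hws.le (hwB x s hs.le) (by linarith)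
  have hwp0 : 0 < w x s ^ (p - 1) := Real.rpow_pos_of_pos hws _
  set W := w x s
  set Λ := lap (fun z => u z s) x
  have i1 : W ^ (p - 1) * Λ + 1 / (p * (τ + s)) ≤ 0 := by
    have : W * (W ^ (p - 1) * Λ + 1 / (p * (τ + s))) ≤ 0 := by
      rw [hwp] at htime
      calc _ = W ^ (p - 1) * W * Λ - -(W / (p * (τ + s))) := by ring
        _ ≤ 0 := htime
    by_contra hc'
    push Not at hc'
    have := mul_pos hws hc'
    linarith
  have i2 : -(W ^ (p - 1) * (2 * n * (B s / R ^ 2))) ≤ W ^ (p - 1) * Λ := by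
    have := mul_le_mul_of_nonneg_left hlap hwp0.le
    linarith
  have i3 : W ^ (p - 1) * (2 * n * (B s / R ^ 2)) ≤ B s ^ (p - 1) * (2 * n * (B s / R ^ 2)) :=
    mul_le_mul_of_nonneg_right hmono (by positivity)
  have i4 : B s ^ (p - 1) * (2 * n * (B s / R ^ 2)) = 2 * n * c ^ p / (τ + s) := by
    have : B s ^ (p - 1) * (2 * n * (B s / R ^ 2)) = 2 * n * (B s ^ p) / R ^ 2 := by
      rw [hBp1]; ring
    rw [this, hBp s hs.le]
    field_simp
  have i5 : 2 * n * c ^ p / (τ + s) < 1 / (p * (τ + s)) := by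
    rw [div_lt_div_iff₀ hts (by positivity)]
    nlinarith
  linarith

/-- The `L^∞` norm of a continuous function dominates each value. -/
lemma le_eLpNorm_top {n : ℕ} {f : EuclideanSpace ℝ (Fin n) → ℝ} (hf : Continuous f)
    (x : EuclideanSpace ℝ (Fin n)) : ENNReal.ofReal (f x) ≤ eLpNorm f ⊤ volume := by
  rw [eLpNorm_exponent_top]
  have h1 : ∀ᵐ y ∂(volume : Measure (EuclideanSpace ℝ (Fin n))),
      ‖f y‖ₑ ≤ eLpNormEssSup f volume := ae_le_eLpNormEssSup
  have hd : Dense {y | ‖f y‖ₑ ≤ eLpNormEssSup f volume} := Measure.dense_of_ae h1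
  have hcl : IsClosed {y | ‖f y‖ₑ ≤ eLpNormEssSup f volume} :=
    isClosed_le hf.enorm continuous_const
  have hx : x ∈ {y | ‖f y‖ₑ ≤ eLpNormEssSup f volume} := by
    rw [← hcl.closure_eq, hd.closure_eq]; trivial
  refine le_trans ?_ hx
  rw [← ofReal_norm]
  exact ENNReal.ofReal_le_ofReal (le_abs_self _)

lemma asymp {p c c₀ α β γ : ℝ} (hp : 1 ≤ p) (hc : 0 < c) (hc₀ : 0 < c₀) (hβ : 0 < β) (hγ : 0 < γ) :
    ∀ᶠ t : ℝ in atTop, c * ((Real.log (Real.log t) / (2 * β)) ^ (2 / γ) / t) ^ (1 / p)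
      < c₀ * Real.exp (-α * Real.sqrt (Real.log t)) := by
  have hp0 : 0 < p := by linarith
  set ε : ℝ := (c₀ / (2 * c)) ^ p with hε
  have hε0 : 0 < ε := by positivity
  have hb0 : 0 < (2 * β) ^ (2 / γ) := by positivity
  have hx1 : ∀ᶠ x : ℝ in atTop, Real.log x ^ (2 / γ) ≤ (ε * (2 * β) ^ (2 / γ) / 2) * x := by
    have := (isLittleO_log_rpow_rpow_atTop (2 / γ) (one_pos)).bound
      (c := ε * (2 * β) ^ (2 / γ) / 2) (by positivity)
    filter_upwards [this, eventually_ge_atTop 1] with x hx hx1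
    rw [Real.rpow_one, Real.norm_of_nonneg (Real.rpow_nonneg (Real.log_nonneg hx1) _),
      Real.norm_of_nonneg (by linarith)] at hx
    exact hx
  have hx2 : ∀ᶠ x : ℝ in atTop, 2 * p * α ≤ Real.sqrt x :=
    Real.tendsto_sqrt_atTop.eventually_ge_atTop _
  filter_upwards [Real.tendsto_log_atTop.eventually hx1, Real.tendsto_log_atTop.eventually hx2,
    Real.tendsto_log_atTop.eventually_ge_atTop 1, eventually_gt_atTop 0] with t h1 h2 h3 ht
  set x := Real.log t with hx
  have hxt : t = Real.exp x := (Real.exp_log ht).symm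
  have hl : 0 ≤ Real.log x := Real.log_nonneg h3
  have a1 : (Real.log x / (2 * β)) ^ (2 / γ) ≤ ε * Real.exp (x / 2) := by
    rw [Real.div_rpow hl (by positivity), div_le_iff₀ hb0]
    have := Real.add_one_le_exp (x / 2)
    calc _ ≤ (ε * (2 * β) ^ (2 / γ) / 2) * x := h1
      _ = (ε * (2 * β) ^ (2 / γ)) * (x / 2) := by ring
      _ ≤ (ε * (2 * β) ^ (2 / γ)) * Real.exp (x / 2) := by gcongr; linarith
      _ = _ := by ring
  have a2 : (Real.log x / (2 * β)) ^ (2 / γ) / t ≤ ε * Real.exp (-(x / 2)) := by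
    rw [div_le_iff₀ ht, hxt, mul_assoc, ← Real.exp_add]
    have e : -(x / 2) + x = x / 2 := by ring
    rw [e]
    exact a1
  have a3 : ((Real.log x / (2 * β)) ^ (2 / γ) / t) ^ (1 / p)
      ≤ (c₀ / (2 * c)) * Real.exp (-(x / 2) * (1 / p)) := by
    calc _ ≤ (ε * Real.exp (-(x / 2))) ^ (1 / p) :=
          Real.rpow_le_rpow (by positivity) a2 (by positivity)
      _ = _ := by
        rw [Real.mul_rpow hε0.le (Real.exp_pos _).le, ← Real.exp_mul, hε,
          ← Real.rpow_mul (by positivity), mul_one_div_cancel hp0.ne', Real.rpow_one]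
  have a4 : -(x / 2) * (1 / p) ≤ -α * Real.sqrt x := by
    have hsq : Real.sqrt x * Real.sqrt x = x := Real.mul_self_sqrt (by linarith)
    have := mul_le_mul_of_nonneg_right h2 (Real.sqrt_nonneg x)
    have : -(x / 2) * (1 / p) = -(x / (2 * p)) := by field_simp
    rw [this, neg_mul, neg_le_neg_iff, le_div_iff₀ (by positivity)]
    linarith
  have a5 : Real.exp (-(x / 2) * (1 / p)) ≤ Real.exp (-α * Real.sqrt x) := Real.exp_le_exp.mpr a4
  calc _ ≤ c * ((c₀ / (2 * c)) * Real.exp (-α * Real.sqrt x)) := by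
        gcongr
        exact a3.trans (by gcongr)
    _ = c₀ / 2 * Real.exp (-α * Real.sqrt x) := by field_simp
    _ < _ := by
      have := Real.exp_pos (-α * Real.sqrt x)
      gcongr
      linarith

/-- Corollary 1.8 of Fila–Winkler.
If `p ≥ 1` and `u₀ ∈ C⁰(ℝⁿ)` satisfies `u₀(x) ≥ c₀ exp(-α exp(β|x|^γ))`, then there are
`t₀ > e` and `C > 0` such that every positive classical solution satisfies
`‖u(·,t)‖_{L^∞(ℝⁿ)} ≥ C t^{-1/p} (ln ln t)^{2/(pγ)}` for all `t ≥ t₀`, the `L^∞`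
norm being the essential supremum `eLpNorm · ∞`. -/
theorem stmt_14 (n : ℕ) (hn : 1 ≤ n)
    (p c₀ α β γ : ℝ) (hp : 1 ≤ p) (hc₀ : 0 < c₀) (hα : 0 < α) (hβ : 0 < β) (hγ : 0 < γ)
    (u₀ : EuclideanSpace ℝ (Fin n) → ℝ)
    (hu₀cont : Continuous u₀)
    (hu₀dec : ∀ x, c₀ * Real.exp (-α * Real.exp (β * ‖x‖ ^ γ)) ≤ u₀ x) :
    ∃ t₀ > Real.exp 1, ∃ C > (0:ℝ), ∀ u : EuclideanSpace ℝ (Fin n) → ℝ → ℝ,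
      IsSol n p u₀ u → ∀ t ≥ t₀,
      ENNReal.ofReal (C * t ^ (-(1:ℝ)/p) * Real.log (Real.log t) ^ (2/(p*γ))) ≤
        eLpNorm (fun x => u x t) ⊤ volume := by
  have hp0 : 0 < p := by linarith
  set c : ℝ := (1 / (2 * n * p + 1)) ^ (1 / p) with hc
  have hden : 0 < 2 * (n:ℝ) * p + 1 := by positivity
  have hc0 : 0 < c := by positivity
  have hcn : 2 * n * p * c ^ p < 1 := by
    rw [hc, ← Real.rpow_mul (by positivity), one_div_mul_cancel hp0.ne', Real.rpow_one,
      mul_one_div, div_lt_one hden]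
    linarith
  have hev := (asymp (α := α) hp hc0 hc₀ hβ hγ).and ((eventually_gt_atTop (Real.exp 1)).and
    (Real.tendsto_log_atTop.eventually_gt_atTop 1))
  obtain ⟨T, hT⟩ := eventually_atTop.mp hev
  refine ⟨max T (Real.exp 1 + 1), lt_of_lt_of_le (by linarith) (le_max_right _ _),
    c * (1 / 2) ^ (1 / p) * (1 / (2 * β)) ^ (2 / (p * γ)), by positivity, ?_⟩
  intro u hu t ht
  obtain ⟨h1, h2, h3⟩ := hT t (le_trans (le_max_left _ _) ht)
  have ht0 : 0 < t := (Real.exp_pos 1).trans h2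
  set l := Real.log (Real.log t) with hl
  have hl0 : 0 < l := Real.log_pos h3
  set R : ℝ := (l / (2 * β)) ^ (1 / γ) with hR
  have hR0 : 0 < R := by positivity
  have hR2 : R ^ 2 = (l / (2 * β)) ^ (2 / γ) := by
    rw [hR, ← Real.rpow_natCast, ← Real.rpow_mul (by positivity)]
    congr 1
    push_cast; ring
  have hRγ : R ^ γ = l / (2 * β) := by
    rw [hR, ← Real.rpow_mul (by positivity), one_div_mul_cancel hγ.ne', Real.rpow_one]
  have hexp : Real.exp (β * R ^ γ) = Real.sqrt (Real.log t) := by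
    rw [hRγ, Real.sqrt_eq_rpow, Real.rpow_def_of_pos (by linarith)]
    congr 1
    field_simp
    rfl
  have h0 : ∀ x, ‖x‖ ≤ R → c * (R ^ 2 / t) ^ (1 / p) < u₀ x := by
    intro x hx
    rw [hR2]
    refine lt_of_lt_of_le h1 (le_trans ?_ (hu₀dec x))
    rw [← hexp]
    have : Real.exp (β * ‖x‖ ^ γ) ≤ Real.exp (β * R ^ γ) := by gcongr
    have h5 : -α * Real.exp (β * R ^ γ) ≤ -α * Real.exp (β * ‖x‖ ^ γ) := by nlinarith
    exact mul_le_mul_of_nonneg_left (Real.exp_le_exp.mpr h5) hc₀.le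
  have hmain := comparison hp hu hR0 ht0 hc0 hcn h0 ht0
  refine le_trans ?_ (le_eLpNorm_top (hu.2.2.2.1 t ht0).continuous 0)
  apply ENNReal.ofReal_le_ofReal
  refine le_trans (le_of_eq ?_) hmain
  have e : R ^ 2 / (t + t) = (1 / 2) * t⁻¹ * ((1 / (2 * β)) ^ (2 / γ) * l ^ (2 / γ)) := by
    rw [← Real.mul_rpow (by positivity) hl0.le, hR2, one_div_mul_eq_div]
    field_simp
    ring
  rw [e, Real.mul_rpow (by positivity) (by positivity), Real.mul_rpow (by positivity)
    (by positivity), Real.mul_rpow (by positivity) (by positivity), ← Real.rpow_mul (by positivity),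
    ← Real.rpow_mul hl0.le, Real.inv_rpow ht0.le, ← Real.rpow_neg ht0.le]
  have e1 : 2 / γ * (1 / p) = 2 / (p * γ) := by field_simp
  have e2 : -(1 / p) = -1 / p := by ring
  rw [e1, e2]
  ring
end

section
/- Let κ > 0 and M ≥ 2, and define L : [0,∞) → ℝ by L(0) = 0, L(s) = (ln(M/s))^{−κ} for s ∈ (0,M/2), and L(s) = (ln 2)^{−κ} for s ≥ M/2. Then L ∈ C⁰([0,∞)) ∩ C²((0,M/2)) is positive and nondecreasing on (0,∞); the function s ↦ s·L'(s) is nondecreasing on (0,M/2); and for any λ₀ > 0, setting a := κ if κ ≤ 1 and a := ((1+λ₀)^κ − 1)/λ₀ if κ > 1, one has L(s) ≤ (1+aλ)·L(s^{1+λ}) for all s > 0 and all λ ∈ (0,λ₀). -/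
open Real Set

/-- The function `L` of Lemma 3.8 of Fila–Winkler: `L(0) = 0`,
`L(s) = (ln(M/s))^{-κ}` for `0 < s < M/2` and `L(s) = (ln 2)^{-κ}` for `s ≥ M/2`
(extended by `0` to negative arguments). -/
noncomputable def L15 (κ M : ℝ) : ℝ → ℝ := fun s =>
  if s ≤ 0 then 0
  else if s < M / 2 then Real.log (M / s) ^ (-κ)
  else Real.log 2 ^ (-κ)

noncomputable def G15 (M s : ℝ) : ℝ := max (Real.log M - Real.log s) (Real.log 2)

lemma G15_ge (M s : ℝ) : Real.log 2 ≤ G15 M s := le_max_right _ _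

lemma log2_pos : 0 < Real.log 2 := Real.log_pos (by norm_num)

lemma G15_pos (M s : ℝ) : 0 < G15 M s := log2_pos.trans_le (G15_ge M s)

lemma L15_eq (κ M : ℝ) (hM : 2 ≤ M) (s : ℝ) (hs : 0 < s) :
    L15 κ M s = G15 M s ^ (-κ) := by
  unfold L15 G15
  have hM0 : 0 < M := by linarith
  rw [if_neg (not_le.2 hs)]
  have e : Real.log (M / 2) = Real.log M - Real.log 2 :=
    Real.log_div hM0.ne' (by norm_num)
  split_ifs with h
  · have := Real.log_lt_log hs h
    rw [Real.log_div hM0.ne' hs.ne', max_eq_left (by linarith)]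
  · have := Real.log_le_log (by linarith) (not_lt.1 h)
    rw [max_eq_right (by linarith)]

lemma log_gt (M : ℝ) (hM : 2 ≤ M) (s : ℝ) (hs : s ∈ Set.Ioo 0 (M / 2)) :
    0 < Real.log M - Real.log s := by
  have := Real.log_lt_log hs.1 (show s < M by linarith [hs.2])
  linarith

lemma L15_eq2 (κ M : ℝ) (hM : 2 ≤ M) (s : ℝ) (hs : s ∈ Set.Ioo 0 (M / 2)) :
    L15 κ M s = (Real.log M - Real.log s) ^ (-κ) := by
  unfold L15
  rw [if_neg (not_le.2 hs.1), if_pos hs.2, Real.log_div (by linarith) hs.1.ne']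

lemma L15_deriv (κ M : ℝ) (hM : 2 ≤ M) (s : ℝ) (hs : s ∈ Set.Ioo 0 (M / 2)) :
    s * deriv (L15 κ M) s = κ * (Real.log M - Real.log s) ^ (-κ - 1) := by
  have hs0 : s ≠ 0 := hs.1.ne'
  have h1 : HasDerivAt (fun x => (Real.log M - Real.log x) ^ (-κ))
      ((-(s⁻¹)) * (-κ) * (Real.log M - Real.log s) ^ (-κ - 1)) s :=
    ((Real.hasDerivAt_log hs0).const_sub (Real.log M)).rpow_const (Or.inl (log_gt M hM s hs).ne')
  have h2 : L15 κ M =ᶠ[nhds s] (fun x => (Real.log M - Real.log x) ^ (-κ)) := by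
    filter_upwards [isOpen_Ioo.mem_nhds hs] with x hx
    exact L15_eq2 κ M hM x hx
  rw [h2.deriv_eq, h1.deriv]
  field_simp

lemma G15_anti (M s t : ℝ) (hs : 0 < s) (h : s ≤ t) : G15 M t ≤ G15 M s := by
  unfold G15
  have := Real.log_le_log hs h
  exact max_le_max (by linarith) le_rfl

lemma L15_cont (κ M : ℝ) (hκ : 0 < κ) (hM : 2 ≤ M) :
    ContinuousOn (L15 κ M) (Set.Ici 0) := by
  intro s hs
  rcases (Set.mem_Ici.1 hs).eq_or_lt with h | h
  · subst h
    have hz : L15 κ M 0 = 0 := by simp [L15]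
    rw [← Set.Ioi_insert, continuousWithinAt_insert_self]
    unfold ContinuousWithinAt
    rw [hz]
    have h1 : Filter.Tendsto (fun x => G15 M x) (nhdsWithin 0 (Set.Ioi 0)) Filter.atTop := by
      apply Filter.tendsto_atTop_mono (f := fun x => Real.log M + - Real.log x)
      · intro x
        unfold G15
        exact le_trans (by linarith) (le_max_left _ _)
      · exact Filter.tendsto_atTop_add_const_left _ _
          (Filter.tendsto_neg_atBot_atTop.comp Real.tendsto_log_nhdsGT_zero)
    have h2 := (tendsto_rpow_neg_atTop hκ).comp h1
    refine h2.congr' ?_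
    filter_upwards [self_mem_nhdsWithin] with x hx
    exact (L15_eq κ M hM x hx).symm
  · apply ContinuousAt.continuousWithinAt
    have h2 : (fun x => G15 M x ^ (-κ)) =ᶠ[nhds s] L15 κ M := by
      filter_upwards [isOpen_Ioi.mem_nhds h] with x hx
      exact (L15_eq κ M hM x hx).symm
    refine ContinuousAt.congr ?_ h2
    refine ContinuousAt.rpow_const ?_ (Or.inl (G15_pos M s).ne')
    unfold G15
    exact (continuousAt_const.sub (Real.continuousAt_log h.ne')).max continuousAt_const

lemma bern15 (κ l₀ l : ℝ) (hκ : 0 < κ) (hl : l ∈ Set.Ioo 0 l₀) :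
    (1 + l) ^ κ ≤ 1 + (if κ ≤ 1 then κ else ((1 + l₀) ^ κ - 1) / l₀) * l := by
  obtain ⟨h0, h1⟩ := hl
  have hl0 : 0 < l₀ := h0.trans h1
  split_ifs with h
  · exact rpow_one_add_le_one_add_mul_self (by linarith) hκ.le h
  · have ha : 0 ≤ 1 - l / l₀ := by
      rw [sub_nonneg, div_le_one hl0]; exact h1.le
    have hb : 0 ≤ l / l₀ := by positivity
    have hc := (convexOn_rpow (not_le.1 h).le).2
      (Set.mem_Ici.2 (zero_le_one (α := ℝ))) (Set.mem_Ici.2 (show 0 ≤ 1 + l₀ by linarith))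
      ha hb (by ring)
    simp only [smul_eq_mul, Real.one_rpow] at hc
    have e : (1 - l / l₀) * 1 + l / l₀ * (1 + l₀) = 1 + l := by field_simp; ring
    rw [e] at hc
    refine hc.trans (le_of_eq ?_)
    field_simp
    ring

/-- Lemma 3.8 of Fila–Winkler.
For `κ > 0` and `M ≥ 2`, the function `L = L15 κ M` belongs to
`C⁰([0,∞)) ∩ C²((0,M/2))`, is positive and nondecreasing on `(0,∞)`,
`s ↦ s·L'(s)` is nondecreasing on `(0,M/2)`, and for every `λ₀ > 0`, with
`a = κ` if `κ ≤ 1` and `a = ((1+λ₀)^κ - 1)/λ₀` if `κ > 1`, one has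
`L(s) ≤ (1 + aλ)·L(s^{1+λ})` for all `s > 0` and `λ ∈ (0,λ₀)`. -/
theorem stmt_15 (κ M : ℝ) (hκ : 0 < κ) (hM : 2 ≤ M) :
    ContinuousOn (L15 κ M) (Set.Ici 0) ∧
    ContDiffOn ℝ 2 (L15 κ M) (Set.Ioo 0 (M / 2)) ∧
    (∀ s ∈ Set.Ioi (0:ℝ), 0 < L15 κ M s) ∧
    MonotoneOn (L15 κ M) (Set.Ioi 0) ∧
    MonotoneOn (fun s => s * deriv (L15 κ M) s) (Set.Ioo 0 (M / 2)) ∧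
    ∀ lam₀ > (0:ℝ), ∀ s > (0:ℝ), ∀ l ∈ Set.Ioo 0 lam₀,
      L15 κ M s ≤
        (1 + (if κ ≤ 1 then κ else ((1 + lam₀) ^ κ - 1) / lam₀) * l) *
          L15 κ M (s ^ (1 + l)) := by
  refine ⟨L15_cont κ M hκ hM, ?_, ?_, ?_, ?_, ?_⟩
  · refine ContDiffOn.congr (f := fun x => (Real.log M - Real.log x) ^ (-κ)) ?_
      (fun x hx => L15_eq2 κ M hM x hx)
    refine ContDiffOn.rpow_const_of_ne ?_ (fun x hx => (log_gt M hM x hx).ne')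
    exact contDiffOn_const.sub (contDiffOn_id.log (fun x hx => hx.1.ne'))
  · intro s hs
    rw [L15_eq κ M hM s hs]
    exact Real.rpow_pos_of_pos (G15_pos M s) _
  · intro s hs t ht h
    rw [L15_eq κ M hM s hs, L15_eq κ M hM t ht]
    exact Real.rpow_le_rpow_of_nonpos (G15_pos M t) (G15_anti M s t hs h) (by linarith)
  · intro s hs t ht h
    simp only
    rw [L15_deriv κ M hM s hs, L15_deriv κ M hM t ht]
    have := Real.log_le_log hs.1 h
    exact mul_le_mul_of_nonneg_left
      (Real.rpow_le_rpow_of_nonpos (log_gt M hM t ht) (by linarith) (by linarith)) hκ.le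
  · intro l₀ hl₀ s hs l hl
    have hb := bern15 κ l₀ l hκ hl
    have hp : 0 < s ^ (1 + l) := Real.rpow_pos_of_pos hs _
    rw [L15_eq κ M hM s hs, L15_eq κ M hM _ hp]
    have hl0 : 0 < l := hl.1
    have hG : G15 M (s ^ (1 + l)) ≤ (1 + l) * G15 M s := by
      have hlM : 0 ≤ Real.log M := Real.log_nonneg (by linarith)
      have a1 : Real.log M - Real.log s ≤ G15 M s := le_max_left _ _
      have a2 := G15_ge M s
      have a3 := log2_pos
      rw [G15, Real.log_rpow hs]
      apply max_le
      · nlinarith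
      · nlinarith
    have h3 := Real.rpow_le_rpow_of_nonpos (G15_pos M _) hG (show -κ ≤ 0 by linarith)
    rw [Real.mul_rpow (by linarith) (G15_pos M s).le] at h3
    have h4 : (1 + l) ^ κ * (1 + l) ^ (-κ) = 1 := by
      rw [← Real.rpow_add (by linarith)]; simp
    have h5 : 0 < (1 + l) ^ κ := Real.rpow_pos_of_pos (by linarith) _
    calc G15 M s ^ (-κ) = (1 + l) ^ κ * ((1 + l) ^ (-κ) * G15 M s ^ (-κ)) := by
          rw [← mul_assoc, h4, one_mul]
      _ ≤ (1 + l) ^ κ * G15 M (s ^ (1 + l)) ^ (-κ) := mul_le_mul_of_nonneg_left h3 h5.le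
      _ ≤ _ := mul_le_mul_of_nonneg_right hb (Real.rpow_pos_of_pos (G15_pos M _) _).le
end

section
/- Let κ > 0, M > e and s₀ ∈ [1, M/e), and define L : [0,∞) → ℝ by L(0) = 0, L(s) = (ln ln(M/s))^{−κ} for s ∈ (0,s₀), and L(s) = (ln ln(M/s₀))^{−κ} for s ≥ s₀. Then L ∈ C⁰([0,∞)) ∩ C²((0,s₀)) is positive and nondecreasing on (0,∞); the function s ↦ s·L'(s) is nondecreasing on (0,s₀); and for any λ₀ > 0 there exists a > 0 such that L(s) ≤ (1+aλ)·L(s^{1+λ}) for all s > 0 and all λ ∈ (0,λ₀). -/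
open Real Set

/-- The function `L` of Lemma 3.11 of Fila–Winkler: `L(0) = 0`,
`L(s) = (ln ln(M/s))^{-κ}` for `0 < s < s₀` and `L(s) = (ln ln(M/s₀))^{-κ}` for `s ≥ s₀`
(extended by `0` to negative arguments). -/
noncomputable def L17 (κ M s₀ : ℝ) : ℝ → ℝ := fun s =>
  if s ≤ 0 then 0
  else if s < s₀ then Real.log (Real.log (M / s)) ^ (-κ)
  else Real.log (Real.log (M / s₀)) ^ (-κ)

lemma L17_loglog_pos {M s₀ s : ℝ} (hs : 0 < s) (hss : s ≤ s₀) (h : s₀ < M / Real.exp 1) :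
    1 < Real.log (M / s) ∧ 0 < Real.log (Real.log (M / s)) := by
  have h1 : s < M / Real.exp 1 := lt_of_le_of_lt hss h
  have h2 : Real.exp 1 < M / s := by
    rw [lt_div_iff₀ (Real.exp_pos 1)] at h1
    rw [lt_div_iff₀ hs]; linarith
  have h3 : 1 < Real.log (M / s) := by
    rw [Real.lt_log_iff_exp_lt (lt_trans (Real.exp_pos 1) h2)]; exact h2
  exact ⟨h3, Real.log_pos h3⟩

lemma L17_eq_min {κ M s₀ s : ℝ} (hs : 0 < s) :
    L17 κ M s₀ s = Real.log (Real.log (M / min s s₀)) ^ (-κ) := by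
  unfold L17
  rw [if_neg (not_le.2 hs)]
  split_ifs with h
  · rw [min_eq_left h.le]
  · rw [min_eq_right (not_lt.1 h)]

lemma L17_F_contDiffAt {κ M s₀ s : ℝ} (hs : 0 < s) (hss : s ≤ s₀) (h : s₀ < M / Real.exp 1)
    (hM : 0 < M) :
    ContDiffAt ℝ 2 (fun s => Real.log (Real.log (M / s)) ^ (-κ)) s := by
  obtain ⟨h1, h2⟩ := L17_loglog_pos hs hss h
  refine ContDiffAt.rpow_const_of_ne ?_ h2.ne'
  refine ContDiffAt.log ?_ (by linarith)
  refine ContDiffAt.log ?_ (by positivity)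
  exact contDiffAt_const.div contDiffAt_id hs.ne'

lemma L17_F_hasDerivAt {κ M s₀ s : ℝ} (hs : 0 < s) (hss : s ≤ s₀) (h : s₀ < M / Real.exp 1)
    (hM : 0 < M) :
    HasDerivAt (fun s => Real.log (Real.log (M / s)) ^ (-κ))
      (κ * (Real.log (M / s))⁻¹ * Real.log (Real.log (M / s)) ^ (-κ - 1) / s) s := by
  obtain ⟨h1, h2⟩ := L17_loglog_pos hs hss h
  have a1 : HasDerivAt (fun s : ℝ => M / s) (-M / s ^ 2) s := by
    have := (hasDerivAt_inv hs.ne').const_mul M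
    have h3 : HasDerivAt (fun s : ℝ => M / s) (M * -(s ^ 2)⁻¹) s := this
    exact h3.congr_deriv (by ring)
  have a2 := a1.log (by positivity)
  have a3 := a2.log (by linarith)
  have a4 := a3.rpow_const (p := -κ) (Or.inl h2.ne')
  convert a4 using 1
  have : Real.log (M / s) ≠ 0 := by linarith
  field_simp

lemma L17_F_mono {κ M a b s₀ : ℝ} (hκ : 0 ≤ κ) (ha : 0 < a) (hab : a ≤ b) (hb : b ≤ s₀)
    (h : s₀ < M / Real.exp 1) (hM : 0 < M) :
    Real.log (Real.log (M / a)) ^ (-κ) ≤ Real.log (Real.log (M / b)) ^ (-κ) := by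
  obtain ⟨h1, h2⟩ := L17_loglog_pos (lt_of_lt_of_le ha hab) hb h
  have hb0 := lt_of_lt_of_le ha hab
  refine Real.rpow_le_rpow_of_nonpos h2 ?_ (by linarith)
  apply Real.log_le_log (by linarith)
  apply Real.log_le_log (by positivity)
  gcongr

lemma L17_mono {κ M s₀ : ℝ} (hκ : 0 < κ) (hs₀ : 0 < s₀) (h : s₀ < M / Real.exp 1) (hM : 0 < M) :
    MonotoneOn (L17 κ M s₀) (Set.Ioi 0) := by
  intro a ha b hb hab
  rw [L17_eq_min ha, L17_eq_min hb]
  exact L17_F_mono hκ.le (lt_min ha hs₀) (min_le_min_right _ hab) (min_le_right _ _) h hM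

lemma L17_tendsto_zero {κ M : ℝ} (hκ : 0 < κ) (hM : 0 < M) :
    Filter.Tendsto (fun s => Real.log (Real.log (M / s)) ^ (-κ))
      (nhdsWithin 0 (Set.Ioi 0)) (nhds 0) := by
  have h1 : Filter.Tendsto (fun s : ℝ => M / s) (nhdsWithin 0 (Set.Ioi 0)) Filter.atTop := by
    simp only [div_eq_mul_inv]
    exact tendsto_inv_nhdsGT_zero.const_mul_atTop hM
  exact (tendsto_rpow_neg_atTop hκ).comp
    (Real.tendsto_log_atTop.comp (Real.tendsto_log_atTop.comp h1))

lemma L17_last {κ M s l lam₀ : ℝ} (hκ : 0 < κ) (hM : 1 < Real.log M) (hM0 : 0 < M) (hs : 0 < s)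
    (hs1 : s < 1) (hl : 0 < l) (hl' : l < lam₀) :
    Real.log (Real.log (M / s)) ^ (-κ) ≤
      (1 + (κ / Real.log (Real.log M) * Real.exp (κ / Real.log (Real.log M) * lam₀)) * l)
        * Real.log (Real.log (M / s ^ (1 + l))) ^ (-κ) := by
  set c := Real.log (Real.log M) with hc
  have hc0 : 0 < c := Real.log_pos hM
  have hx : Real.log s < 0 := Real.log_neg hs hs1
  rw [Real.log_div hM0.ne' hs.ne', Real.log_div hM0.ne' (Real.rpow_pos_of_pos hs _).ne',
    Real.log_rpow hs]
  set m := Real.log M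
  set x := Real.log s
  set w := Real.log (m - x) with hw
  set w' := Real.log (m - (1 + l) * x) with hw'
  have hlx : l * x < 0 := mul_neg_of_pos_of_neg hl hx
  have hcw : c ≤ w := Real.log_le_log (by linarith) (by linarith)
  have hww : w ≤ w' := Real.log_le_log (by linarith) (by nlinarith)
  have hw'w : w' ≤ w + l := by
    have : w' ≤ Real.log ((1 + l) * (m - x)) :=
      Real.log_le_log (by nlinarith) (by nlinarith)
    rw [Real.log_mul (by linarith) (by linarith)] at this
    have h2 := Real.log_le_sub_one_of_pos (show 0 < 1 + l by linarith)
    linarith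
  have hw0 : 0 < w := by linarith
  have hw'0 : 0 < w' := by linarith
  have key : w' / w ≤ Real.exp (l / c) := by
    have h1 : w' / w ≤ 1 + l / c := by
      rw [div_le_iff₀ hw0]
      have : l ≤ l / c * w := by
        rw [div_mul_eq_mul_div, le_div_iff₀ hc0]; nlinarith
      linarith
    have := Real.add_one_le_exp (l / c)
    linarith
  have key2 : (w' / w) ^ κ ≤ Real.exp (κ / c * l) := by
    calc (w' / w) ^ κ ≤ (Real.exp (l / c)) ^ κ := Real.rpow_le_rpow (by positivity) key hκ.le
      _ = Real.exp (κ / c * l) := by rw [← Real.exp_mul]; congr 1; ring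
  have key3 : Real.exp (κ / c * l) ≤ 1 + (κ / c * Real.exp (κ / c * lam₀)) * l := by
    have h1 := Real.add_one_le_exp (-(κ / c * l))
    have h2 : Real.exp (-(κ / c * l)) * Real.exp (κ / c * l) = 1 := by
      rw [← Real.exp_add]; simp
    have h3 : Real.exp (κ / c * l) ≤ Real.exp (κ / c * lam₀) := by gcongr
    have h4 : 0 < κ / c * l := by positivity
    have h5 := Real.exp_pos (κ / c * l)
    nlinarith
  have e : w ^ (-κ) = (w' / w) ^ κ * w' ^ (-κ) := by
    rw [Real.div_rpow hw'0.le hw0.le, Real.rpow_neg hw0.le, Real.rpow_neg hw'0.le]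
    have := (Real.rpow_pos_of_pos hw'0 κ).ne'
    field_simp
  rw [e]
  exact mul_le_mul_of_nonneg_right (key2.trans key3) (by positivity)

/-- Lemma 3.11 of Fila–Winkler.
For `κ > 0`, `M > e` and `s₀ ∈ [1, M/e)`, the function `L = L17 κ M s₀` belongs to
`C⁰([0,∞)) ∩ C²((0,s₀))`, is positive and nondecreasing on `(0,∞)`,
`s ↦ s·L'(s)` is nondecreasing on `(0,s₀)`, and for every `λ₀ > 0` there is `a > 0`
such that `L(s) ≤ (1 + aλ)·L(s^{1+λ})` for all `s > 0` and `λ ∈ (0,λ₀)`. -/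
theorem stmt_17 (κ M s₀ : ℝ) (hκ : 0 < κ) (hM : Real.exp 1 < M)
    (hs₀ : s₀ ∈ Set.Ico (1:ℝ) (M / Real.exp 1)) :
    ContinuousOn (L17 κ M s₀) (Set.Ici 0) ∧
    ContDiffOn ℝ 2 (L17 κ M s₀) (Set.Ioo 0 s₀) ∧
    (∀ s ∈ Set.Ioi (0:ℝ), 0 < L17 κ M s₀ s) ∧
    MonotoneOn (L17 κ M s₀) (Set.Ioi 0) ∧
    MonotoneOn (fun s => s * deriv (L17 κ M s₀) s) (Set.Ioo 0 s₀) ∧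
    ∀ lam₀ > (0:ℝ), ∃ a > (0:ℝ), ∀ s > (0:ℝ), ∀ l ∈ Set.Ioo 0 lam₀,
      L17 κ M s₀ s ≤ (1 + a * l) * L17 κ M s₀ (s ^ (1 + l)) := by
  obtain ⟨h1, hlt⟩ := hs₀
  have hM0 : 0 < M := (Real.exp_pos 1).trans hM
  have hs0 : 0 < s₀ := by linarith
  have hmono := L17_mono hκ hs0 hlt hM0
  have hpos : ∀ s ∈ Set.Ioi (0:ℝ), 0 < L17 κ M s₀ s := by
    intro s hs
    rw [L17_eq_min hs]
    exact Real.rpow_pos_of_pos (L17_loglog_pos (lt_min hs hs0) (min_le_right _ _) hlt).2 _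
  have heq : ∀ s ∈ Set.Ioo 0 s₀, L17 κ M s₀ s = Real.log (Real.log (M / s)) ^ (-κ) := by
    intro s hs
    rw [L17_eq_min hs.1, min_eq_left hs.2.le]
  refine ⟨?_, ?_, hpos, hmono, ?_, ?_⟩
  · intro s hs
    rcases eq_or_lt_of_le (show 0 ≤ s from hs) with h0 | h0
    · subst h0
      rw [← continuousWithinAt_Ioi_iff_Ici]
      have hz : L17 κ M s₀ 0 = 0 := by simp [L17]
      unfold ContinuousWithinAt
      rw [hz]
      refine (L17_tendsto_zero hκ hM0).congr' ?_
      filter_upwards [Ioo_mem_nhdsGT hs0] with t ht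
      exact (heq t ht).symm
    · have hc : ContinuousAt (fun t => Real.log (Real.log (M / min t s₀)) ^ (-κ)) s := by
        have hF := (L17_F_contDiffAt (κ := κ) (lt_min h0 hs0) (min_le_right s s₀) hlt
          hM0).continuousAt
        have hm : ContinuousAt (fun t : ℝ => min t s₀) s := by fun_prop
        exact ContinuousAt.comp (f := fun t : ℝ => min t s₀) hF hm
      refine (hc.congr ?_).continuousWithinAt
      filter_upwards [Ioi_mem_nhds h0] with t ht
      exact (L17_eq_min ht).symm
  · refine ContDiffOn.congr (fun s hs => ?_) heq
    exact (L17_F_contDiffAt hs.1 hs.2.le hlt hM0).contDiffWithinAt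
  · have hd : ∀ s ∈ Set.Ioo 0 s₀, s * deriv (L17 κ M s₀) s =
        κ * ((Real.log (M / s))⁻¹ * Real.log (Real.log (M / s)) ^ (-(κ + 1))) := by
      intro s hs
      have : L17 κ M s₀ =ᶠ[nhds s] (fun s => Real.log (Real.log (M / s)) ^ (-κ)) := by
        filter_upwards [Ioo_mem_nhds hs.1 hs.2] with t ht
        exact heq t ht
      rw [this.deriv_eq, (L17_F_hasDerivAt hs.1 hs.2.le hlt hM0).deriv,
        show -(κ + 1) = -κ - 1 by ring]
      have := hs.1.ne'
      field_simp
    intro a ha b hb hab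
    simp only
    rw [hd a ha, hd b hb]
    have hF := L17_F_mono (κ := κ + 1) (by linarith) ha.1 hab hb.2.le hlt hM0
    obtain ⟨hb1, hb2⟩ := L17_loglog_pos hb.1 hb.2.le hlt
    obtain ⟨ha1, ha2⟩ := L17_loglog_pos ha.1 ha.2.le hlt
    have hlog : Real.log (M / b) ≤ Real.log (M / a) := by
      have h3 := ha.1
      have h4 := hb.1
      apply Real.log_le_log (by positivity)
      gcongr
    have hinv : (Real.log (M / a))⁻¹ ≤ (Real.log (M / b))⁻¹ := by
      apply inv_anti₀ (by linarith) hlog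
    apply mul_le_mul_of_nonneg_left _ hκ.le
    apply mul_le_mul hinv hF (by positivity)
    exact inv_nonneg.2 (by linarith)
  · intro lam₀ hlam
    have hm1 : 1 < Real.log M := by
      rw [Real.lt_log_iff_exp_lt hM0]; exact hM
    have hc0 := Real.log_pos hm1
    refine ⟨κ / Real.log (Real.log M) * Real.exp (κ / Real.log (Real.log M) * lam₀),
      by positivity, ?_⟩
    intro s hs l hl
    have hsl : 0 < s ^ (1 + l) := Real.rpow_pos_of_pos hs _
    rcases lt_or_ge s 1 with h | h
    · have hsl1 : s ^ (1 + l) < 1 := Real.rpow_lt_one hs.le h (by linarith [hl.1])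
      rw [heq s ⟨hs, by linarith⟩, heq _ ⟨hsl, by linarith⟩]
      exact L17_last hκ hm1 hM0 hs h hl.1 hl.2
    · have hle : s ≤ s ^ (1 + l) := by
        have := Real.rpow_le_rpow_of_exponent_le h (show 1 ≤ 1 + l by linarith [hl.1])
        rwa [Real.rpow_one] at this
      have h2 := hmono hs hsl hle
      have h3 := hpos _ hsl
      have h4 : 0 ≤ κ / Real.log (Real.log M) * Real.exp (κ / Real.log (Real.log M) * lam₀) * l :=
        mul_nonneg (by positivity) hl.1.le
      nlinarith
end
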